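/- Let e : ℝ^{n_x} → ℝ^{n_x}, f : ℝ^{n_x} × ℝ^{n_u} → ℝ^{n_x}, g : ℝ^{n_x} × ℝ^{n_u} → ℝ^{n_y} be continuously differentiable, let P be a real symmetric positive definite n_x×n_x matrix and μ > 0, and denote by E(x), F(x,u), G(x,u) the Jacobians of e, f, g with respect to x. Suppose that for all x ∈ ℝ^{n_x} and u ∈ ℝ^{n_u}, F(x,u)ᵀP⁻¹F(x,u) − E(x) − E(x)ᵀ + P + μI + G(x,u)ᵀG(x,u) is negative semidefinite. Then for any input sequence (u_t)_{t≥1} and any two state sequences (x̄_t)_{t≥1} and (x̂_t)_{t≥1} satisfying e(x̄_{t+1}) = f(x̄_t, u_t) and e(x̂_{t+1}) = f(x̂_t, u_t) for all t ≥ 1, the sequences t ↦ ‖x̄_t − x̂_t‖² and t ↦ ‖g(x̄_t, u_t) − g(x̂_t, u_t)‖² are summable. -/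

import Mathlib

open Matrix

/-- The Jacobian matrix of a map `ℝ^n → ℝ^m` at `x`. -/
noncomputable def jacobian {n m : ℕ} (e : (Fin n → ℝ) → (Fin m → ℝ)) (x : Fin n → ℝ) :
    Matrix (Fin m) (Fin n) ℝ :=
  LinearMap.toMatrix' (fderiv ℝ e x).toLinearMap

theorem aux_deriv {n m : ℕ} (e : (Fin n → ℝ) → (Fin m → ℝ)) (he : Differentiable ℝ e)
    (w : Fin m → ℝ) (x v : Fin n → ℝ) (s : ℝ) :
    HasDerivAt (fun s : ℝ => w ⬝ᵥ e (x + s • v)) (w ⬝ᵥ (jacobian e (x + s • v) *ᵥ v)) s := by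
  have h1 : HasDerivAt (fun s : ℝ => x + s • v) v s := by
    simpa using ((hasDerivAt_id s).smul_const v).const_add x
  have h2 : HasDerivAt (fun s : ℝ => e (x + s • v)) (fderiv ℝ e (x + s • v) v) s :=
    (he (x + s • v)).hasFDerivAt.comp_hasDerivAt s h1
  have h3 : jacobian e (x + s • v) *ᵥ v = fderiv ℝ e (x + s • v) v := by
    simp [jacobian, LinearMap.toMatrix'_mulVec]
  rw [h3]
  rw [hasDerivAt_pi] at h2
  unfold dotProduct
  exact HasDerivAt.fun_sum fun i _ => (h2 i).const_mul (w i)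

theorem aux_quad {n : ℕ} (Q : Matrix (Fin n) (Fin n) ℝ) (hQ : Q.IsSymm)
    (hpos : ∀ v : Fin n → ℝ, 0 ≤ v ⬝ᵥ (Q *ᵥ v)) (a b : Fin n → ℝ) :
    2 * (a ⬝ᵥ (Q *ᵥ b)) ≤ a ⬝ᵥ (Q *ᵥ a) + b ⬝ᵥ (Q *ᵥ b) := by
  have h := hpos (a - b)
  have hs : b ⬝ᵥ (Q *ᵥ a) = a ⬝ᵥ (Q *ᵥ b) := by
    rw [dotProduct_mulVec, ← mulVec_transpose, hQ.eq, dotProduct_comm]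
  simp only [mulVec_sub, dotProduct_sub, sub_dotProduct] at h
  linarith

theorem aux_dot {n : ℕ} (a : Fin n → ℝ) : 0 ≤ a ⬝ᵥ a :=
  Finset.sum_nonneg fun i _ => mul_self_nonneg (a i)

theorem aux_sum (V p : ℕ → ℝ) (hV : ∀ t, 0 ≤ V t) (hp : ∀ t, 0 ≤ p t)
    (h : ∀ t, 1 ≤ t → V (t + 1) + p t ≤ V t) : Summable p := by
  rw [← summable_nat_add_iff 1]
  refine summable_of_sum_range_le (c := V 1) (fun n => hp _) fun n => ?_
  have : ∑ i ∈ Finset.range n, p (i + 1) + V (n + 1) ≤ V 1 := by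
    induction n with
    | zero => simp
    | succ k ih =>
      rw [Finset.sum_range_succ]
      linarith [h (k + 1) (by omega)]
  linarith [hV (n + 1)]

/-- global incremental ℓ² stability: if the contraction condition
`F(x,u)ᵀP⁻¹F(x,u) − E(x) − E(x)ᵀ + P + μI + G(x,u)ᵀG(x,u) ⪯ 0` holds for all `(x,u)`,
then for any input and any two solutions of the implicit model
`e(x_{t+1}) = f(x_t, u_t)`, the squared state differences and squared output
differences are summable. -/
theorem contraction_implies_incremental_l2_stability
    (nx nu ny : ℕ)
    (e : (Fin nx → ℝ) → (Fin nx → ℝ))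
    (f : (Fin nx → ℝ) → (Fin nu → ℝ) → (Fin nx → ℝ))
    (g : (Fin nx → ℝ) → (Fin nu → ℝ) → (Fin ny → ℝ))
    (he : ContDiff ℝ 1 e)
    (hf : ContDiff ℝ 1 (fun q : (Fin nx → ℝ) × (Fin nu → ℝ) => f q.1 q.2))
    (hg : ContDiff ℝ 1 (fun q : (Fin nx → ℝ) × (Fin nu → ℝ) => g q.1 q.2))
    (P : Matrix (Fin nx) (Fin nx) ℝ) (hPsymm : P.IsSymm)
    (hPpd : ∀ v : Fin nx → ℝ, v ≠ 0 → 0 < v ⬝ᵥ (P *ᵥ v))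
    (μ : ℝ) (hμ : 0 < μ)
    (hcontract : ∀ (x : Fin nx → ℝ) (u : Fin nu → ℝ) (v : Fin nx → ℝ),
      v ⬝ᵥ (((jacobian (f · u) x)ᵀ * P⁻¹ * jacobian (f · u) x
        - jacobian e x - (jacobian e x)ᵀ + P
        + μ • (1 : Matrix (Fin nx) (Fin nx) ℝ)
        + (jacobian (g · u) x)ᵀ * jacobian (g · u) x) *ᵥ v) ≤ 0) :
    ∀ (u : ℕ → Fin nu → ℝ) (xb xh : ℕ → Fin nx → ℝ),
      (∀ t, 1 ≤ t → e (xb (t + 1)) = f (xb t) (u t)) →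
      (∀ t, 1 ≤ t → e (xh (t + 1)) = f (xh t) (u t)) →
      Summable (fun t : ℕ => (xb t - xh t) ⬝ᵥ (xb t - xh t)) ∧
        Summable (fun t : ℕ =>
          (g (xb t) (u t) - g (xh t) (u t)) ⬝ᵥ (g (xb t) (u t) - g (xh t) (u t))) := by
  intro u xb xh hxb hxh
  set Q := P⁻¹ with hQdef
  have hPD : P.PosDef := by
    refine Matrix.PosDef.of_dotProduct_mulVec_pos ?_ ?_
    · rw [Matrix.IsHermitian, conjTranspose_eq_transpose_of_trivial, hPsymm.eq]
    · intro v hv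
      simpa using hPpd v hv
  have hQsymm : Q.IsSymm := by
    rw [hQdef, Matrix.IsSymm, transpose_nonsing_inv, hPsymm.eq]
  have hQpos : ∀ v : Fin nx → ℝ, 0 ≤ v ⬝ᵥ (Q *ᵥ v) := by
    intro v
    simpa using hPD.inv.posSemidef.dotProduct_mulVec_nonneg v
  have hQP : Q * P = 1 := Matrix.nonsing_inv_mul P ((Matrix.isUnit_iff_isUnit_det P).1 hPD.isUnit)
  have key : ∀ (w : Fin nu → ℝ) (x y : Fin nx → ℝ),
      (f y w - f x w) ⬝ᵥ (Q *ᵥ (f y w - f x w)) + (g y w - g x w) ⬝ᵥ (g y w - g x w)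
        + μ * ((y - x) ⬝ᵥ (y - x)) ≤ (e y - e x) ⬝ᵥ (Q *ᵥ (e y - e x)) := by
    intro w x y
    have hfd : Differentiable ℝ (f · w) :=
      (hf.differentiable (by norm_num)).comp (differentiable_id.prodMk (differentiable_const w))
    have hgd : Differentiable ℝ (g · w) :=
      (hg.differentiable (by norm_num)).comp (differentiable_id.prodMk (differentiable_const w))
    have hed : Differentiable ℝ e := he.differentiable (by norm_num)
    obtain ⟨v, hv⟩ : ∃ v, v = y - x := ⟨_, rfl⟩
    obtain ⟨a, ha⟩ : ∃ a, a = f y w - f x w := ⟨_, rfl⟩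
    obtain ⟨b, hb⟩ : ∃ b, b = g y w - g x w := ⟨_, rfl⟩
    obtain ⟨d, hd⟩ : ∃ d, d = e y - e x := ⟨_, rfl⟩
    rw [← hv, ← ha, ← hb, ← hd]
    obtain ⟨c, hc⟩ : ∃ c, c = μ * (v ⬝ᵥ v) + v ⬝ᵥ (P *ᵥ v) - a ⬝ᵥ (Q *ᵥ a) - b ⬝ᵥ b := ⟨_, rfl⟩
    let h : ℝ → ℝ := fun s => 2 * ((Q *ᵥ a) ⬝ᵥ f (x + s • v) w) + 2 * (b ⬝ᵥ g (x + s • v) w)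
      - 2 * (v ⬝ᵥ e (x + s • v)) + s * c
    have hder : ∀ s, HasDerivAt h (2 * ((Q *ᵥ a) ⬝ᵥ (jacobian (f · w) (x + s • v) *ᵥ v))
        + 2 * (b ⬝ᵥ (jacobian (g · w) (x + s • v) *ᵥ v))
        - 2 * (v ⬝ᵥ (jacobian e (x + s • v) *ᵥ v)) + 1 * c) s := fun s =>
      ((((aux_deriv (f · w) hfd (Q *ᵥ a) x v s).const_mul 2).add
        ((aux_deriv (g · w) hgd b x v s).const_mul 2)).sub
        ((aux_deriv e hed v x v s).const_mul 2)).add ((hasDerivAt_id s).mul_const c)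
    have hanti : Antitone h := by
      refine antitone_of_deriv_nonpos (fun s => (hder s).differentiableAt) fun s => ?_
      rw [(hder s).deriv]
      have hcon := hcontract (x + s • v) w v
      generalize jacobian (f · w) (x + s • v) = F at *
      generalize jacobian (g · w) (x + s • v) = G at *
      generalize jacobian e (x + s • v) = E at *
      have t1 : v ⬝ᵥ ((Fᵀ * Q * F) *ᵥ v) = (F *ᵥ v) ⬝ᵥ (Q *ᵥ (F *ᵥ v)) := by
        rw [Matrix.mul_assoc, ← mulVec_mulVec, ← mulVec_mulVec, dotProduct_mulVec,
          vecMul_transpose]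
      have t2 : v ⬝ᵥ ((Gᵀ * G) *ᵥ v) = (G *ᵥ v) ⬝ᵥ (G *ᵥ v) := by
        rw [← mulVec_mulVec, dotProduct_mulVec, vecMul_transpose]
      have t3 : v ⬝ᵥ (Eᵀ *ᵥ v) = v ⬝ᵥ (E *ᵥ v) := by
        rw [dotProduct_mulVec, vecMul_transpose, dotProduct_comm]
      simp only [add_mulVec, sub_mulVec, dotProduct_add, dotProduct_sub, smul_mulVec,
        one_mulVec, dotProduct_smul, smul_eq_mul, t1, t2, t3] at hcon
      have q1 := aux_quad Q hQsymm hQpos (F *ᵥ v) a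
      rw [dotProduct_comm] at q1
      have q2 := aux_quad (1 : Matrix (Fin ny) (Fin ny) ℝ) Matrix.isSymm_one
        (fun z => by simpa using aux_dot z) b (G *ᵥ v)
      simp only [one_mulVec] at q2
      linarith
    have h01 := hanti (zero_le_one (α := ℝ))
    have hxy : x + v = y := by rw [hv]; abel
    simp only [h, one_smul, zero_smul, add_zero, hxy] at h01
    have r1 : (Q *ᵥ a) ⬝ᵥ f y w - (Q *ᵥ a) ⬝ᵥ f x w = a ⬝ᵥ (Q *ᵥ a) := by
      rw [← dotProduct_sub, ← ha, dotProduct_comm]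
    have r2 : b ⬝ᵥ g y w - b ⬝ᵥ g x w = b ⬝ᵥ b := by
      rw [← dotProduct_sub, ← hb]
    have r3 : v ⬝ᵥ e y - v ⬝ᵥ e x = v ⬝ᵥ d := by
      rw [← dotProduct_sub, ← hd]
    have q := aux_quad Q hQsymm hQpos d (P *ᵥ v)
    rw [mulVec_mulVec, hQP, one_mulVec, dotProduct_comm d v, dotProduct_comm (P *ᵥ v) v] at q
    linarith
  have step : ∀ t, 1 ≤ t → (e (xb (t+1)) - e (xh (t+1))) ⬝ᵥ (Q *ᵥ (e (xb (t+1)) - e (xh (t+1))))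
      + ((g (xb t) (u t) - g (xh t) (u t)) ⬝ᵥ (g (xb t) (u t) - g (xh t) (u t))
        + μ * ((xb t - xh t) ⬝ᵥ (xb t - xh t)))
      ≤ (e (xb t) - e (xh t)) ⬝ᵥ (Q *ᵥ (e (xb t) - e (xh t))) := by
    intro t ht
    rw [hxb t ht, hxh t ht]
    linarith [key (u t) (xh t) (xb t)]
  have hV : ∀ t, 0 ≤ (e (xb t) - e (xh t)) ⬝ᵥ (Q *ᵥ (e (xb t) - e (xh t))) := fun t => hQpos _
  constructor
  · have := aux_sum (fun t => (e (xb t) - e (xh t)) ⬝ᵥ (Q *ᵥ (e (xb t) - e (xh t))))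
      (fun t => μ * ((xb t - xh t) ⬝ᵥ (xb t - xh t))) hV
      (fun t => mul_nonneg hμ.le (aux_dot _))
      (fun t ht => by linarith [step t ht, aux_dot (g (xb t) (u t) - g (xh t) (u t))])
    exact (summable_mul_left_iff hμ.ne').1 this
  · exact aux_sum (fun t => (e (xb t) - e (xh t)) ⬝ᵥ (Q *ᵥ (e (xb t) - e (xh t)))) _ hV
      (fun t => aux_dot _)
      (fun t ht => by linarith [step t ht, mul_nonneg hμ.le (aux_dot (xb t - xh t))])
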